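/- In the MIL TPAUC setting with mean pooling, assume ℓ is non-decreasing, C_ℓ-Lipschitz continuous and L_ℓ-weakly-convex, each bag score w ↦ h_i(w) is L₀-smooth, and each per-instance estimator w ↦ h_i(w;ξ) is C₀-Lipschitz continuous. Then: (i) f(u,s') = s' + (u − s')₊/α is jointly convex in (u,s'), non-decreasing in u, and Lipschitz continuous; (ii) g(v,s) = s + (ℓ(v) − s)₊/β is (L_ℓ/β)-weakly-convex and non-decreasing in v, convex in s, and Lipschitz continuous in (v,s); (iii) h_{i,j}(w) = h_j(w) − h_i(w) is 2L₀-weakly-convex and w ↦ h_j(w;ζ) − h_i(w;ξ) is 2C₀-Lipschitz continuous; (iv) the composite map (w,s,s') ↦ f(g(h_{i,j}(w), s), s') is ρ-weakly-convex in the joint variable (w,s,s') with ρ = (1/(αβ))·(4C₀²·L_ℓ + 2C_ℓ·L₀). -/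

import Mathlib

noncomputable section

/-- A real-valued function on a real inner product space is `ρ`-weakly convex if
adding `ρ/2 ‖·‖²` makes it convex. -/
def WeaklyConvex {E : Type*} [NormedAddCommGroup E] [InnerProductSpace ℝ E]
    (ρ : ℝ) (f : E → ℝ) : Prop :=
  ConvexOn ℝ Set.univ fun x => f x + ρ / 2 * ‖x‖ ^ 2

/-- A vector-valued function is `ρ`-weakly convex if each component is. -/
def WeaklyConvexVec {E : Type*} [NormedAddCommGroup E] [InnerProductSpace ℝ E]
    {m : ℕ} (ρ : ℝ) (g : E → EuclideanSpace ℝ (Fin m)) : Prop :=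
  ∀ j : Fin m, WeaklyConvex ρ fun x => g x j

/-- `f` is `C`-Lipschitz continuous. -/
def LipschitzC {E F : Type*} [NormedAddCommGroup E] [NormedAddCommGroup F]
    (C : ℝ) (f : E → F) : Prop :=
  ∀ x y, ‖f x - f y‖ ≤ C * ‖x - y‖

/-- A scalar function on `ℝ^m` is non-decreasing with respect to each coordinate
of the input. -/
def CoordNonDecreasing {m : ℕ} (f : EuclideanSpace ℝ (Fin m) → ℝ) : Prop :=
  ∀ (k : Fin m) (x : EuclideanSpace ℝ (Fin m)),
    Monotone fun t : ℝ => f (x + t • EuclideanSpace.single k (1 : ℝ))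

/-- A scalar function on `ℝ^m` is monotone: with respect to each coordinate of the
input it is either non-decreasing or non-increasing. -/
def CoordMonotone {m : ℕ} (f : EuclideanSpace ℝ (Fin m) → ℝ) : Prop :=
  ∀ k : Fin m,
    (∀ x, Monotone fun t : ℝ => f (x + t • EuclideanSpace.single k (1 : ℝ))) ∨
    (∀ x, Antitone fun t : ℝ => f (x + t • EuclideanSpace.single k (1 : ℝ)))

/-- A vector-valued function is non-decreasing if each component is non-decreasing
with respect to each coordinate of the input. -/
def CoordNonDecreasingVec {m₁ m₂ : ℕ}
    (g : EuclideanSpace ℝ (Fin m₁) → EuclideanSpace ℝ (Fin m₂)) : Prop :=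
  ∀ j : Fin m₂, CoordNonDecreasing fun x => g x j

/-- A vector-valued function is monotone if each component is monotone. -/
def CoordMonotoneVec {m₁ m₂ : ℕ}
    (g : EuclideanSpace ℝ (Fin m₁) → EuclideanSpace ℝ (Fin m₂)) : Prop :=
  ∀ j : Fin m₂, CoordMonotone fun x => g x j

/-- `f` is `L`-smooth: differentiable with `L`-Lipschitz derivative. -/
def SmoothL {E F : Type*} [NormedAddCommGroup E] [NormedSpace ℝ E]
    [NormedAddCommGroup F] [NormedSpace ℝ F] (L : ℝ) (f : E → F) : Prop :=
  Differentiable ℝ f ∧ ∀ x y, ‖fderiv ℝ f x - fderiv ℝ f y‖ ≤ L * ‖x - y‖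

/-- `v` is a general subgradient of `f` at `x`:
`f y ≥ f x + ⟪v, y - x⟫ + o(‖y - x‖)` as `y → x`. -/
def IsSubgradient {E : Type*} [NormedAddCommGroup E] [InnerProductSpace ℝ E]
    (f : E → ℝ) (x v : E) : Prop :=
  ∀ ε > 0, ∃ δ > 0, ∀ y, ‖y - x‖ < δ →
    f x + @inner ℝ _ _ v (y - x) - ε * ‖y - x‖ ≤ f y

open Finset

/-- Weak convexity of a function of a joint variable `(w, s, s') ∈ E × ℝ × ℝ`, with
respect to the Euclidean (ℓ²) structure on the product. -/
def WeaklyConvexJoint {E : Type*} [NormedAddCommGroup E] [InnerProductSpace ℝ E]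
    (ρ : ℝ) (f : E → ℝ → ℝ → ℝ) : Prop :=
  ConvexOn ℝ Set.univ fun p : E × ℝ × ℝ =>
    f p.1 p.2.1 p.2.2 + ρ / 2 * (‖p.1‖ ^ 2 + p.2.1 ^ 2 + p.2.2 ^ 2)

section WeakConvexity

variable {E : Type*} [NormedAddCommGroup E] [InnerProductSpace ℝ E]

theorem convexComb_norm_sq (x y : E) {a b : ℝ} (hab : a + b = 1) :
    ‖a • x + b • y‖ ^ 2 = a * ‖x‖ ^ 2 + b * ‖y‖ ^ 2 - a * b * ‖x - y‖ ^ 2 := by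
  rw [norm_add_sq_real, norm_sub_sq_real, norm_smul, norm_smul, inner_smul_left,
    inner_smul_right, mul_pow, mul_pow, Real.norm_eq_abs, Real.norm_eq_abs, sq_abs, sq_abs]
  obtain rfl : b = 1 - a := by linarith
  simp only [conj_trivial]
  ring

theorem weaklyConvex_iff {ρ : ℝ} {f : E → ℝ} :
    WeaklyConvex ρ f ↔ ∀ (x y : E) (a b : ℝ), 0 ≤ a → 0 ≤ b → a + b = 1 →
      f (a • x + b • y) ≤ a * f x + b * f y + ρ / 2 * (a * b * ‖x - y‖ ^ 2) := by
  constructor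
  · intro h x y a b ha hb hab
    have := h.2 (Set.mem_univ x) (Set.mem_univ y) ha hb hab
    simp only [convexComb_norm_sq x y hab, smul_eq_mul] at this
    linarith
  · intro h
    refine ⟨convex_univ, fun x _ y _ a b ha hb hab => ?_⟩
    simp only [convexComb_norm_sq x y hab, smul_eq_mul]
    linarith [h x y a b ha hb hab]

theorem SmoothL.sub {L₁ L₂ : ℝ} {f g : E → ℝ} (hf : SmoothL L₁ f) (hg : SmoothL L₂ g) :
    SmoothL (L₁ + L₂) fun x => f x - g x := by
  refine ⟨hf.1.sub hg.1, fun x y => ?_⟩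
  rw [fderiv_fun_sub (hf.1 x) (hg.1 x), fderiv_fun_sub (hf.1 y) (hg.1 y), sub_sub_sub_comm,
    add_mul]
  exact (norm_sub_le _ _).trans (add_le_add (hf.2 x y) (hg.2 x y))

theorem SmoothL.lower_quadratic_bound {L : ℝ} {f : E → ℝ} (hf : SmoothL L f) (x v : E) :
    f x + fderiv ℝ f x v - L / 2 * ‖v‖ ^ 2 ≤ f (x + v) := by
  have hd : ∀ t : ℝ, HasDerivAt
      (fun t : ℝ => f (x + t • v) - t * fderiv ℝ f x v + L / 2 * ‖v‖ ^ 2 * t ^ 2)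
      (fderiv ℝ f (x + t • v) v - fderiv ℝ f x v + L * ‖v‖ ^ 2 * t) t := by
    intro t
    have hline : HasDerivAt (fun t : ℝ => x + t • v) v t := by
      simpa using ((hasDerivAt_id t).smul_const v).const_add x
    have hcomp := (hf.1 (x + t • v)).hasFDerivAt.comp_hasDerivAt t hline
    have hlin := (hasDerivAt_id t).mul_const (fderiv ℝ f x v)
    have hsq := ((hasDerivAt_id t).pow 2).const_mul (L / 2 * ‖v‖ ^ 2)
    refine ((hcomp.sub hlin).add hsq).congr_deriv ?_
    simp only [id, one_mul]
    push_cast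
    ring
  have hmono : MonotoneOn
      (fun t : ℝ => f (x + t • v) - t * fderiv ℝ f x v + L / 2 * ‖v‖ ^ 2 * t ^ 2)
      (Set.Ici 0) := by
    refine monotoneOn_of_deriv_nonneg (convex_Ici 0)
      (fun t _ => (hd t).continuousAt.continuousWithinAt)
      (fun t _ => (hd t).differentiableAt.differentiableWithinAt) fun t ht => ?_
    rw [interior_Ici] at ht
    rw [(hd t).deriv]
    have hL := hf.2 (x + t • v) x
    rw [add_sub_cancel_left, norm_smul, Real.norm_eq_abs, abs_of_pos ht] at hL
    have hop := (fderiv ℝ f (x + t • v) - fderiv ℝ f x).le_opNorm v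
    have := hop.trans (mul_le_mul_of_nonneg_right hL (norm_nonneg v))
    rw [sub_apply, Real.norm_eq_abs] at this
    linarith [(abs_le.1 this).1]
  have := hmono (Set.mem_Ici.2 le_rfl) (Set.mem_Ici.2 zero_le_one) zero_le_one
  simp only [zero_smul, add_zero, one_smul] at this
  linarith

theorem SmoothL.weaklyConvex {L : ℝ} {f : E → ℝ} (hf : SmoothL L f) : WeaklyConvex L f := by
  refine weaklyConvex_iff.2 fun x y a b ha hb hab => ?_
  obtain rfl : a = 1 - b := by linarith
  set z := (1 - b) • x + b • y with hz
  have hx := hf.lower_quadratic_bound z (b • (x - y))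
  have hy := hf.lower_quadratic_bound z (-((1 - b) • (x - y)))
  rw [show z + b • (x - y) = x by rw [hz]; module] at hx
  rw [show z + -((1 - b) • (x - y)) = y by rw [hz]; module] at hy
  rw [map_smul, norm_smul, mul_pow, Real.norm_eq_abs, sq_abs, smul_eq_mul] at hx
  rw [map_neg, map_smul, norm_neg, norm_smul, mul_pow, Real.norm_eq_abs, sq_abs,
    smul_eq_mul] at hy
  have hx' := mul_le_mul_of_nonneg_left hx ha
  have hy' := mul_le_mul_of_nonneg_left hy hb
  linear_combination hx' + hy'

theorem WeaklyConvex.comp_monotone {C L C' L' : ℝ} {φ : ℝ → ℝ} {f : E → ℝ}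
    (hL : 0 ≤ L) (hL' : 0 ≤ L') (hφ : WeaklyConvex L φ) (hmono : Monotone φ)
    (hlip : LipschitzC C φ) (hf : WeaklyConvex L' f) (hflip : LipschitzC C' f) :
    WeaklyConvex (C' ^ 2 * L + C * L') fun x => φ (f x) := by
  refine weaklyConvex_iff.2 fun x y a b ha hb hab => ?_
  have hfz := weaklyConvex_iff.1 hf x y a b ha hb hab
  have hφz := weaklyConvex_iff.1 hφ (f x) (f y) a b ha hb hab
  simp only [smul_eq_mul] at hφz
  set m := a * f x + b * f y
  set e := L' / 2 * (a * b * ‖x - y‖ ^ 2) with he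
  have he0 : 0 ≤ e := by positivity
  have hshift : φ (m + e) ≤ φ m + C * e := by
    have := hlip (m + e) m
    rw [add_sub_cancel_left, Real.norm_eq_abs, Real.norm_eq_abs, abs_of_nonneg he0] at this
    linarith [le_abs_self (φ (m + e) - φ m)]
  have hsq : L / 2 * (a * b * ‖f x - f y‖ ^ 2) ≤
      L / 2 * (a * b * (C' * ‖x - y‖) ^ 2) := by
    gcongr
    exact hflip x y
  have := hmono hfz
  rw [he] at hshift this
  linarith

end WeakConvexity

theorem LipschitzC.sub {E : Type*} [NormedAddCommGroup E] {C₁ C₂ : ℝ} {f g : E → ℝ}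
    (hf : LipschitzC C₁ f) (hg : LipschitzC C₂ g) :
    LipschitzC (C₁ + C₂) fun x => f x - g x := by
  intro x y
  rw [sub_sub_sub_comm, add_mul]
  exact (norm_sub_le _ _).trans (add_le_add (hf x y) (hg x y))

theorem LipschitzC.average {E ι : Type*} [NormedAddCommGroup E] {C : ℝ} {f : ι → E → ℝ}
    (hf : ∀ k, LipschitzC C (f k)) {I : Finset ι} (hI : I.Nonempty) :
    LipschitzC C fun x => (∑ k ∈ I, f k x) / I.card := by
  intro x y
  have hcard : (0 : ℝ) < I.card := by exact_mod_cast hI.card_pos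
  rw [← sub_div, ← Finset.sum_sub_distrib, norm_div, Real.norm_natCast, div_le_iff₀ hcard]
  refine (norm_sum_le_of_le I fun k _ => hf k x y).trans ?_
  rw [Finset.sum_const, nsmul_eq_mul, mul_comm]

theorem add_max_div_le_convexComb {c u u₁ u₂ s₁ s₂ a b e : ℝ} (hc : 0 < c) (ha : 0 ≤ a)
    (hb : 0 ≤ b) (he : 0 ≤ e) (hu : u ≤ a * u₁ + b * u₂ + e) :
    (a * s₁ + b * s₂) + max (u - (a * s₁ + b * s₂)) 0 / c ≤
      a * (s₁ + max (u₁ - s₁) 0 / c) + b * (s₂ + max (u₂ - s₂) 0 / c) + e / c := by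
  have hmax : max (u - (a * s₁ + b * s₂)) 0 ≤
      a * max (u₁ - s₁) 0 + b * max (u₂ - s₂) 0 + e := by
    refine max_le ?_ (by positivity)
    have h₁ := mul_le_mul_of_nonneg_left (le_max_left (u₁ - s₁) 0) ha
    have h₂ := mul_le_mul_of_nonneg_left (le_max_left (u₂ - s₂) 0) hb
    linarith
  have := div_le_div_of_nonneg_right hmax hc.le
  rw [add_div, add_div, mul_div_assoc, mul_div_assoc] at this
  linarith

theorem monotone_add_max_div {c : ℝ} (hc : 0 < c) (s : ℝ) :
    Monotone fun u : ℝ => s + max (u - s) 0 / c := by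
  intro u v huv
  dsimp only
  gcongr

theorem abs_add_max_div_sub_le {c K r u s u' s' : ℝ} (hc : 0 < c)
    (hu : |u - u'| ≤ K * r) (hs : |s - s'| ≤ r) :
    |(s + max (u - s) 0 / c) - (s' + max (u' - s') 0 / c)| ≤ (1 + (K + 1) / c) * r := by
  have hmax : |max (u - s) 0 - max (u' - s') 0| ≤ (K + 1) * r := by
    refine (abs_max_sub_max_le_abs _ _ _).trans ?_
    rw [sub_sub_sub_comm]
    refine (abs_sub _ _).trans ?_
    linarith
  rw [add_sub_add_comm, ← sub_div]
  refine (abs_add_le _ _).trans ?_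
  rw [abs_div, abs_of_pos hc, add_mul, one_mul, div_mul_eq_mul_div]
  gcongr

/-- Lemma 18. Structural properties of the TPAUC objective in the
multi-instance learning setting with mean pooling. -/
theorem tpauc_mil_weak_convexity
    (d npos nneg : ℕ) (hnpos : 0 < npos) (hnneg : 0 < nneg)
    (α β Cℓ Lℓ L₀ C₀ : ℝ)
    (hα : 0 < α) (hα1 : α ≤ 1) (hβ : 0 < β) (hβ1 : β ≤ 1)
    (hCℓ : 0 ≤ Cℓ) (hLℓ : 0 ≤ Lℓ) (hL₀ : 0 ≤ L₀) (hC₀ : 0 ≤ C₀)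
    (ℓ : ℝ → ℝ)
    (hℓmono : Monotone ℓ) (hℓlip : LipschitzC Cℓ ℓ) (hℓwc : WeaklyConvex Lℓ ℓ)
    -- bags of instances and per-instance score estimators
    (Ξ : Type)
    (instP : Fin npos → Finset Ξ) (instN : Fin nneg → Finset Ξ)
    (hinstP : ∀ i, (instP i).Nonempty) (hinstN : ∀ j, (instN j).Nonempty)
    (hPinst : Fin npos → Ξ → EuclideanSpace ℝ (Fin d) → ℝ)
    (hNinst : Fin nneg → Ξ → EuclideanSpace ℝ (Fin d) → ℝ)
    (hPinstLip : ∀ i ξ, LipschitzC C₀ (hPinst i ξ))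
    (hNinstLip : ∀ j ξ, LipschitzC C₀ (hNinst j ξ))
    -- bag-level scores given by mean pooling
    (hP : Fin npos → EuclideanSpace ℝ (Fin d) → ℝ)
    (hN : Fin nneg → EuclideanSpace ℝ (Fin d) → ℝ)
    (hPdef : ∀ i w, hP i w = (∑ ξ ∈ instP i, hPinst i ξ w) / (instP i).card)
    (hNdef : ∀ j w, hN j w = (∑ ξ ∈ instN j, hNinst j ξ w) / (instN j).card)
    (hPsmooth : ∀ i, SmoothL L₀ (hP i)) (hNsmooth : ∀ j, SmoothL L₀ (hN j)) :
    -- (i) properties of f(u, s') = s' + (u − s')₊/α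
    (ConvexOn ℝ Set.univ fun p : ℝ × ℝ => p.2 + max (p.1 - p.2) 0 / α) ∧
    (∀ s' : ℝ, Monotone fun u : ℝ => s' + max (u - s') 0 / α) ∧
    (∃ C : ℝ, 0 ≤ C ∧ ∀ u s' u' s'' : ℝ,
      |(s' + max (u - s') 0 / α) - (s'' + max (u' - s'') 0 / α)| ≤
        C * Real.sqrt ((u - u') ^ 2 + (s' - s'') ^ 2)) ∧
    -- (ii) properties of g(v, s) = s + (ℓ(v) − s)₊/β
    (∀ s : ℝ, WeaklyConvex (Lℓ / β) fun v : ℝ => s + max (ℓ v - s) 0 / β) ∧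
    (∀ s : ℝ, Monotone fun v : ℝ => s + max (ℓ v - s) 0 / β) ∧
    (∀ v : ℝ, ConvexOn ℝ Set.univ fun s : ℝ => s + max (ℓ v - s) 0 / β) ∧
    (∃ C : ℝ, 0 ≤ C ∧ ∀ v s v' s' : ℝ,
      |(s + max (ℓ v - s) 0 / β) - (s' + max (ℓ v' - s') 0 / β)| ≤
        C * Real.sqrt ((v - v') ^ 2 + (s - s') ^ 2)) ∧
    -- (iii) properties of h_{i,j} = h_j − h_i and its per-instance estimators
    (∀ (i : Fin npos) (j : Fin nneg),
      WeaklyConvex (2 * L₀) fun w => hN j w - hP i w) ∧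
    (∀ (i : Fin npos) (j : Fin nneg) (ξ ζ : Ξ),
      LipschitzC (2 * C₀) fun w => hNinst j ζ w - hPinst i ξ w) ∧
    -- (iv) joint weak convexity of the composite map
    (∀ (i : Fin npos) (j : Fin nneg),
      WeaklyConvexJoint ((4 * C₀ ^ 2 * Lℓ + 2 * Cℓ * L₀) / (α * β))
        fun w s s' =>
          s' + max ((s + max (ℓ (hN j w - hP i w) - s) 0 / β) - s') 0 / α) := by
  have hgap : ∀ i j, WeaklyConvex (2 * L₀) fun w => hN j w - hP i w := fun i j => by
    simpa only [two_mul] using ((hNsmooth j).sub (hPsmooth i)).weaklyConvex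
  have hlip : ∀ i j, LipschitzC (2 * C₀) fun w => hN j w - hP i w := fun i j => by
    have := (LipschitzC.average (hNinstLip j) (hinstN j)).sub
      (LipschitzC.average (hPinstLip i) (hinstP i))
    simpa only [two_mul, ← hPdef, ← hNdef] using this
  have hfst : ∀ p q : ℝ, |p| ≤ Real.sqrt (p ^ 2 + q ^ 2) := fun p q =>
    Real.abs_le_sqrt (by nlinarith [sq_nonneg q])
  have hsnd : ∀ p q : ℝ, |q| ≤ Real.sqrt (p ^ 2 + q ^ 2) := fun p q =>
    Real.abs_le_sqrt (by nlinarith [sq_nonneg p])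
  refine ⟨?_, monotone_add_max_div hα, ?_, ?_,
    fun s => (monotone_add_max_div hβ s).comp hℓmono, ?_, ?_, hgap, ?_, ?_⟩
  · refine ⟨convex_univ, fun p _ q _ a b ha hb _ => ?_⟩
    have := add_max_div_le_convexComb (s₁ := p.2) (s₂ := q.2) hα ha hb le_rfl
      (add_zero (a * p.1 + b * q.1)).ge
    simpa using this
  · exact ⟨1 + (1 + 1) / α, by positivity, fun u s' u' s'' =>
      abs_add_max_div_sub_le hα (by simpa only [one_mul] using hfst _ _) (hsnd _ _)⟩
  · refine fun s => weaklyConvex_iff.2 fun v v' a b ha hb hab => ?_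
    have := add_max_div_le_convexComb (s₁ := s) (s₂ := s) hβ ha hb (by positivity)
      (weaklyConvex_iff.1 hℓwc v v' a b ha hb hab)
    rw [← add_mul, hab, one_mul] at this
    exact this.trans_eq (by ring)
  · refine fun v => ⟨convex_univ, fun s _ s' _ a b ha hb hab => ?_⟩
    have hv : ℓ v ≤ a * ℓ v + b * ℓ v + 0 := by rw [← add_mul, hab, one_mul, add_zero]
    have := add_max_div_le_convexComb (s₁ := s) (s₂ := s') hβ ha hb le_rfl hv
    simpa using this
  · exact ⟨1 + (Cℓ + 1) / β, by positivity, fun v s v' s' =>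
      abs_add_max_div_sub_le hβ
        ((hℓlip v v').trans (mul_le_mul_of_nonneg_left (hfst _ _) hCℓ)) (hsnd _ _)⟩
  · intro i j ξ ζ
    simpa only [two_mul] using (hNinstLip j ζ).sub (hPinstLip i ξ)
  · intro i j
    have hcomp := weaklyConvex_iff.1 (WeaklyConvex.comp_monotone hLℓ (by positivity) hℓwc hℓmono
      hℓlip (hgap i j) (hlip i j))
    refine ⟨convex_univ, ?_⟩
    rintro ⟨w, s, s'⟩ _ ⟨w', t, t'⟩ _ a b ha hb hab
    have hg := add_max_div_le_convexComb (s₁ := s) (s₂ := t) hβ ha hb (by positivity)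
      (hcomp w w' a b ha hb hab)
    have hf := add_max_div_le_convexComb (s₁ := s') (s₂ := t') hα ha hb (by positivity) hg
    have hs := convexComb_norm_sq s t hab
    have hs' := convexComb_norm_sq s' t' hab
    simp only [Real.norm_eq_abs, sq_abs, smul_eq_mul] at hs hs'
    simp only [Prod.smul_mk, Prod.mk_add_mk, smul_eq_mul, convexComb_norm_sq w w' hab, hs, hs']
    have hrest : 0 ≤ (4 * C₀ ^ 2 * Lℓ + 2 * Cℓ * L₀) / (α * β) / 2 *
        (a * b * ((s - t) ^ 2 + (s' - t') ^ 2)) := by positivity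
    have hcoef : ((2 * C₀) ^ 2 * Lℓ + Cℓ * (2 * L₀)) / 2 * (a * b * ‖w - w'‖ ^ 2) / β / α =
        (4 * C₀ ^ 2 * Lℓ + 2 * Cℓ * L₀) / (α * β) / 2 * (a * b * ‖w - w'‖ ^ 2) := by
      field_simp
      ring
    rw [hcoef] at hf
    linarith
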